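/- Let T ⊆ B(H,K) be a TRO, X ⊆ T a nondegenerate sub-TRO, P : T → X a contractive TRO conditional expectation onto X, and let Q' : ⟨T* T⟩ → ⟨T* T⟩ be the unique contractive linear map with Q'(x* a) = x* P(a) for all a ∈ T, x ∈ X. Then for every t ∈ T and every b ∈ ⟨T* T⟩ one has ‖P(t)* P(t) + Q'(b)* Q'(b)‖ ≤ ‖t* t + b* b‖ (norms in B(H)). -/

import Mathlib

noncomputable section

open ContinuousLinearMap

/-- The closed linear span of a set in a complex normed space. -/
def cspan {V : Type*} [NormedAddCommGroup V] [NormedSpace ℂ V] (S : Set V) : Set V :=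
  closure (Submodule.span ℂ S : Set V)

variable {H K : Type*} [NormedAddCommGroup H] [InnerProductSpace ℂ H] [CompleteSpace H]
  [NormedAddCommGroup K] [InnerProductSpace ℂ K] [CompleteSpace K]

/-- The ternary product `a b* c` of operators in `B(H,K)`. -/
def tp (a b c : H →L[ℂ] K) : H →L[ℂ] K :=
  a ∘L ((ContinuousLinearMap.adjoint b) ∘L c)

/-- A TRO: a norm-closed linear subspace of `B(H,K)` stable under `(a,b,c) ↦ a b* c`. -/
def IsTRO (T : Set (H →L[ℂ] K)) : Prop :=
  IsClosed T ∧ (∃ S : Submodule ℂ (H →L[ℂ] K), T = ↑S) ∧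
    ∀ a ∈ T, ∀ b ∈ T, ∀ c ∈ T, tp a b c ∈ T

/-- A sub-TRO of `T`: a norm-closed linear subspace of `T` stable under the ternary product. -/
def IsSubTRO (T X : Set (H →L[ℂ] K)) : Prop :=
  X ⊆ T ∧ IsClosed X ∧ (∃ S : Submodule ℂ (H →L[ℂ] K), X = ↑S) ∧
    ∀ a ∈ X, ∀ b ∈ X, ∀ c ∈ X, tp a b c ∈ X

/-- The set `{a b* : a ∈ T₁, b ∈ T₂} ⊆ B(K)`. -/
def setMulStar (T₁ T₂ : Set (H →L[ℂ] K)) : Set (K →L[ℂ] K) :=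
  {w | ∃ a ∈ T₁, ∃ b ∈ T₂, w = a ∘L ContinuousLinearMap.adjoint b}

/-- The set `{a* b : a ∈ T₁, b ∈ T₂} ⊆ B(H)`. -/
def setStarMul (T₁ T₂ : Set (H →L[ℂ] K)) : Set (H →L[ℂ] H) :=
  {w | ∃ a ∈ T₁, ∃ b ∈ T₂, w = ContinuousLinearMap.adjoint a ∘L b}

/-- Nondegeneracy of a sub-TRO `X ⊆ T`: `⟨X T* T⟩ = T` and `⟨T T* X⟩ = T`. -/
def Nondegenerate (T X : Set (H →L[ℂ] K)) : Prop :=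
  cspan {w | ∃ x ∈ X, ∃ a ∈ T, ∃ b ∈ T, w = tp x a b} = T ∧
  cspan {w | ∃ a ∈ T, ∃ b ∈ T, ∃ x ∈ X, w = tp a b x} = T

/-- A TRO conditional expectation from `T` onto the sub-TRO `X`: a linear idempotent
surjection `P : T → X` (formalised as a map of the ambient space which is linear on `T`,
maps `T` into `X` and fixes `X`) satisfying the three module identities. -/
def IsTROCondExp (T X : Set (H →L[ℂ] K)) (P : (H →L[ℂ] K) → (H →L[ℂ] K)) : Prop :=
  (∀ s ∈ T, ∀ t ∈ T, P (s + t) = P s + P t) ∧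
  (∀ (z : ℂ), ∀ t ∈ T, P (z • t) = z • P t) ∧
  (∀ t ∈ T, P t ∈ X) ∧ (∀ x ∈ X, P x = x) ∧
  (∀ a ∈ T, ∀ x ∈ X, ∀ y ∈ X, P (tp a x y) = tp (P a) x y) ∧
  (∀ a ∈ T, ∀ x ∈ X, ∀ y ∈ X, P (tp x a y) = tp x (P a) y) ∧
  (∀ a ∈ T, ∀ x ∈ X, ∀ y ∈ X, P (tp x y a) = tp x y (P a))

/-- `P` is contractive on the set `S`. -/
def ContractiveOn {V W : Type*} [Norm V] [Norm W] (S : Set V) (P : V → W) : Prop :=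
  ∀ v ∈ S, ‖P v‖ ≤ ‖v‖

/-- The defining properties of the left corner map `Q = P P† : ⟨T T*⟩ → ⟨T T*⟩`:
it maps `⟨T T*⟩` into itself, is linear and contractive on `⟨T T*⟩`
and satisfies `Q(a x*) = P(a) x*` for `a ∈ T`, `x ∈ X`. -/
def IsLeftCornerMap (T X : Set (H →L[ℂ] K))
    (P : (H →L[ℂ] K) → (H →L[ℂ] K)) (Q : (K →L[ℂ] K) → (K →L[ℂ] K)) : Prop :=
  (∀ c ∈ cspan (setMulStar T T), Q c ∈ cspan (setMulStar T T)) ∧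
  (∀ c ∈ cspan (setMulStar T T), ∀ d ∈ cspan (setMulStar T T), Q (c + d) = Q c + Q d) ∧
  (∀ (z : ℂ), ∀ c ∈ cspan (setMulStar T T), Q (z • c) = z • Q c) ∧
  (∀ c ∈ cspan (setMulStar T T), ‖Q c‖ ≤ ‖c‖) ∧
  (∀ a ∈ T, ∀ x ∈ X,
    Q (a ∘L ContinuousLinearMap.adjoint x) = P a ∘L ContinuousLinearMap.adjoint x)

/-- The defining properties of the right corner map `Q' = P† P : ⟨T* T⟩ → ⟨T* T⟩`:
it maps `⟨T* T⟩` into itself, is linear and contractive on `⟨T* T⟩`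
and satisfies `Q'(x* a) = x* P(a)` for `a ∈ T`, `x ∈ X`. -/
def IsRightCornerMap (T X : Set (H →L[ℂ] K))
    (P : (H →L[ℂ] K) → (H →L[ℂ] K)) (Q' : (H →L[ℂ] H) → (H →L[ℂ] H)) : Prop :=
  (∀ d ∈ cspan (setStarMul T T), Q' d ∈ cspan (setStarMul T T)) ∧
  (∀ c ∈ cspan (setStarMul T T), ∀ d ∈ cspan (setStarMul T T), Q' (c + d) = Q' c + Q' d) ∧
  (∀ (z : ℂ), ∀ d ∈ cspan (setStarMul T T), Q' (z • d) = z • Q' d) ∧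
  (∀ d ∈ cspan (setStarMul T T), ‖Q' d‖ ≤ ‖d‖) ∧
  (∀ a ∈ T, ∀ x ∈ X,
    Q' (ContinuousLinearMap.adjoint x ∘L a) = ContinuousLinearMap.adjoint x ∘L P a)

section ClosedSpan

variable {V W : Type*} [NormedAddCommGroup V] [NormedSpace ℂ V]
  [NormedAddCommGroup W] [NormedSpace ℂ W]

theorem subset_cspan (S : Set V) : S ⊆ cspan S :=
  Submodule.subset_span.trans subset_closure

theorem cspan_eq_topologicalClosure (S : Set V) :
    cspan S = ((Submodule.span ℂ S).topologicalClosure : Set V) := rfl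

theorem cspan_subset {S : Set V} {M : Submodule ℂ V} (hM : IsClosed (M : Set V))
    (hS : S ⊆ M) : cspan S ⊆ M :=
  closure_minimal (Submodule.span_le.2 hS) hM

theorem cspan_mono {S S' : Set V} (h : S ⊆ S') : cspan S ⊆ cspan S' :=
  closure_mono (Submodule.span_mono h)

/-- A bounded linear map on `cspan S` that sends `S` into a closed subspace sends all of
`cspan S` into it. -/
theorem mapsTo_cspan {S : Set V} {f : V → W} {C : ℝ} {M : Submodule ℂ W}
    (hM : IsClosed (M : Set W))
    (hadd : ∀ v ∈ cspan S, ∀ w ∈ cspan S, f (v + w) = f v + f w)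
    (hsmul : ∀ (z : ℂ), ∀ v ∈ cspan S, f (z • v) = z • f v)
    (hbound : ∀ v ∈ cspan S, ‖f v‖ ≤ C * ‖v‖)
    (hS : ∀ v ∈ S, f v ∈ M) : ∀ v ∈ cspan S, f v ∈ M := by
  rw [cspan_eq_topologicalClosure] at *
  let g : (Submodule.span ℂ S).topologicalClosure →ₗ[ℂ] W :=
    { toFun := fun v => f v
      map_add' := fun v w => hadd v v.2 w w.2
      map_smul' := fun z v => hsmul z v v.2 }
  let G := g.mkContinuous C fun v => hbound v v.2
  have hspan : ∀ v ∈ Submodule.span ℂ S, f v ∈ M := by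
    have hle := (Submodule.span ℂ S).le_topologicalClosure
    intro v hv
    induction hv using Submodule.span_induction with
    | mem v hv => exact hS v hv
    | zero =>
      have h0 : f 0 = 0 := by simpa using hsmul 0 0 (Submodule.zero_mem _)
      rw [h0]
      exact M.zero_mem
    | add v w hv hw ihv ihw =>
      rw [hadd v (hle hv) w (hle hw)]
      exact M.add_mem ihv ihw
    | smul z v hv ih =>
      rw [hsmul z v (hle hv)]
      exact M.smul_mem z ih
  intro v hv
  obtain ⟨u, hu, hlim⟩ := mem_closure_iff_seq_limit.1 hv
  have hlim' : Filter.Tendsto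
      (fun n => (⟨u n, subset_closure (hu n)⟩ : (Submodule.span ℂ S).topologicalClosure))
      Filter.atTop (nhds ⟨v, hv⟩) := tendsto_subtype_rng.2 hlim
  exact hM.mem_of_tendsto ((G.continuous.tendsto _).comp hlim')
    (Filter.Eventually.of_forall fun n => hspan _ (hu n))

end ClosedSpan

section TRO

variable {T X : Set (H →L[ℂ] K)}

theorem setStarMul_mono {T₁ T₂ X₁ X₂ : Set (H →L[ℂ] K)} (h₁ : X₁ ⊆ T₁) (h₂ : X₂ ⊆ T₂) :
    setStarMul X₁ X₂ ⊆ setStarMul T₁ T₂ := by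
  rintro _ ⟨a, ha, b, hb, rfl⟩
  exact ⟨a, h₁ ha, b, h₂ hb, rfl⟩

theorem IsSubTRO.isTRO (hX : IsSubTRO T X) : IsTRO X := hX.2

theorem IsTRO.comp_mem (hT : IsTRO T) {x : H →L[ℂ] K} (hx : x ∈ T) {w : H →L[ℂ] H}
    (hw : w ∈ cspan (setStarMul T T)) : x ∘L w ∈ T := by
  obtain ⟨hcl, ⟨S, rfl⟩, htp⟩ := hT
  let M : Submodule ℂ (H →L[ℂ] H) := S.comap (ContinuousLinearMap.compL ℂ H H K x).toLinearMap
  have hM : IsClosed (M : Set (H →L[ℂ] H)) :=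
    hcl.preimage (ContinuousLinearMap.compL ℂ H H K x).continuous
  refine cspan_subset hM ?_ hw
  rintro _ ⟨a, ha, b, hb, rfl⟩
  exact htp x hx a ha b hb

theorem adjoint_mem_cspan_setStarMul {w : H →L[ℂ] H} (hw : w ∈ cspan (setStarMul T T)) :
    adjoint w ∈ cspan (setStarMul T T) := by
  let N := (Submodule.span ℂ (setStarMul T T)).topologicalClosure
  let M : Submodule ℂ (H →L[ℂ] H) :=
    { carrier := {w | adjoint w ∈ N}
      add_mem' := fun {v w} hv hw => by
        simpa only [Set.mem_ofPred_eq, map_add] using N.add_mem hv hw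
      zero_mem' := by simp
      smul_mem' := fun z v hv => by
        simpa only [Set.mem_ofPred_eq, map_smulₛₗ] using N.smul_mem _ hv }
  have hM : IsClosed (M : Set (H →L[ℂ] H)) :=
    (Submodule.isClosed_topologicalClosure _).preimage
      (adjoint : (H →L[ℂ] H) ≃ₗᵢ⋆[ℂ] (H →L[ℂ] H)).continuous
  refine cspan_subset hM ?_ hw
  rintro _ ⟨a, ha, b, hb, rfl⟩
  refine subset_cspan _ ⟨b, hb, a, ha, ?_⟩
  rw [adjoint_comp, adjoint_adjoint]

theorem IsTRO.comp_mem_cspan (hT : IsTRO T) {v w : H →L[ℂ] H}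
    (hv : v ∈ cspan (setStarMul T T)) (hw : w ∈ cspan (setStarMul T T)) :
    v ∘L w ∈ cspan (setStarMul T T) := by
  let L := (ContinuousLinearMap.compL ℂ H H H).flip w
  let M := (Submodule.span ℂ (setStarMul T T)).topologicalClosure.comap L.toLinearMap
  have hM : IsClosed (M : Set (H →L[ℂ] H)) :=
    (Submodule.isClosed_topologicalClosure _).preimage L.continuous
  refine cspan_subset hM ?_ hv
  rintro _ ⟨a, ha, b, hb, rfl⟩
  exact subset_cspan _ ⟨a, ha, b ∘L w, hT.comp_mem hb hw, rfl⟩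

/-- For a nondegenerate sub-TRO `X ⊆ T`, the algebra `⟨T* T⟩` is already spanned by `X* T`. -/
theorem Nondegenerate.cspan_eq (hT : IsTRO T) (hXT : X ⊆ T) (h : Nondegenerate T X) :
    cspan (setStarMul T T) = cspan (setStarMul X T) := by
  refine Set.Subset.antisymm ?_ (cspan_mono (setStarMul_mono hXT subset_rfl))
  refine cspan_subset (Submodule.isClosed_topologicalClosure _) ?_
  rintro _ ⟨a, ha, b, hb, rfl⟩
  let N := (Submodule.span ℂ (setStarMul X T)).topologicalClosure
  let M : Submodule ℂ (H →L[ℂ] K) :=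
    { carrier := {a | adjoint a ∘L b ∈ N}
      add_mem' := fun {v w} hv hw => by
        simpa only [Set.mem_ofPred_eq, map_add, add_comp] using N.add_mem hv hw
      zero_mem' := by simp
      smul_mem' := fun z v hv => by
        simpa only [Set.mem_ofPred_eq, map_smulₛₗ, smul_comp] using N.smul_mem _ hv }
  have hM : IsClosed (M : Set (H →L[ℂ] K)) :=
    (Submodule.isClosed_topologicalClosure _).preimage
      (((ContinuousLinearMap.compL ℂ H K H).flip b).continuous.comp
        (adjoint : (H →L[ℂ] K) ≃ₗᵢ⋆[ℂ] (K →L[ℂ] H)).continuous)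
  refine cspan_subset (M := M) hM ?_ (h.2.symm ▸ ha)
  rintro _ ⟨c, hc, d, hd, x, hx, rfl⟩
  refine subset_cspan _ ⟨x, hx, tp d c b, hT.2.2 d hd c hc b hb, ?_⟩
  simp only [tp, adjoint_comp, adjoint_adjoint, comp_assoc]

variable {P : (H →L[ℂ] K) → (H →L[ℂ] K)} {Q' : (H →L[ℂ] H) → (H →L[ℂ] H)}

theorem IsRightCornerMap.mem_cspan (hQ' : IsRightCornerMap T X P Q')
    (hspan : cspan (setStarMul T T) = cspan (setStarMul X T)) (hP : ∀ t ∈ T, P t ∈ X)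
    {b : H →L[ℂ] H} (hb : b ∈ cspan (setStarMul T T)) : Q' b ∈ cspan (setStarMul X X) := by
  obtain ⟨-, hadd, hsmul, hbound, hmod⟩ := hQ'
  rw [hspan] at hadd hsmul hbound hb
  refine mapsTo_cspan (C := 1) (Submodule.isClosed_topologicalClosure _) hadd hsmul
    (by simpa only [one_mul] using hbound) ?_ b hb
  rintro _ ⟨x, hx, a, ha, rfl⟩
  rw [hmod a ha x hx]
  exact subset_cspan _ ⟨x, hx, P a, hP a ha, rfl⟩

/-- The right corner map is a left `⟨X* X⟩`-module map. -/
theorem IsRightCornerMap.map_comp (hQ' : IsRightCornerMap T X P Q')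
    (hT : IsTRO T) (hX : IsSubTRO T X)
    (hspan : cspan (setStarMul T T) = cspan (setStarMul X T))
    {w : H →L[ℂ] H} (hw : w ∈ cspan (setStarMul X X))
    {b : H →L[ℂ] H} (hb : b ∈ cspan (setStarMul T T)) : Q' (w ∘L b) = w ∘L Q' b := by
  obtain ⟨-, hadd, hsmul, hbound, hmod⟩ := hQ'
  have hwT : w ∈ cspan (setStarMul T T) :=
    cspan_mono (setStarMul_mono hX.1 hX.1) hw
  have hmem : ∀ v ∈ cspan (setStarMul X T), w ∘L v ∈ cspan (setStarMul T T) := fun v hv =>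
    hT.comp_mem_cspan hwT (hspan ▸ hv)
  have key : ∀ v ∈ cspan (setStarMul X T),
      Q' (w ∘L v) - w ∘L Q' v ∈ (⊥ : Submodule ℂ (H →L[ℂ] H)) := by
    refine mapsTo_cspan (C := 2 * ‖w‖) (by simp) ?_ ?_ ?_ ?_
    · intro v hv v' hv'
      rw [comp_add, hadd _ (hmem v hv) _ (hmem v' hv'), hadd v (hspan ▸ hv) v' (hspan ▸ hv'),
        comp_add]
      abel
    · intro z v hv
      rw [comp_smul, hsmul z _ (hmem v hv), hsmul z v (hspan ▸ hv), comp_smul, smul_sub]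
    · intro v hv
      have h₁ := (hbound _ (hmem v hv)).trans (opNorm_comp_le w v)
      have h₂ := (opNorm_comp_le w (Q' v)).trans
        (mul_le_mul_of_nonneg_left (hbound v (hspan ▸ hv)) (norm_nonneg w))
      linarith [norm_sub_le (Q' (w ∘L v)) (w ∘L Q' v)]
    · rintro _ ⟨x, hx, a, ha, rfl⟩
      have hxw : x ∘L adjoint w ∈ X := hX.isTRO.comp_mem hx (adjoint_mem_cspan_setStarMul hw)
      have h := hmod a ha _ hxw
      rw [adjoint_comp, adjoint_adjoint, comp_assoc, comp_assoc] at h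
      rw [Submodule.mem_bot, h, hmod a ha x hx, sub_self]
  exact sub_eq_zero.1 ((Submodule.mem_bot ℂ).1 (key b (hspan ▸ hb)))

end TRO

section ColumnNorm

variable {F : Type*} [NormedAddCommGroup F] [InnerProductSpace ℂ F] [CompleteSpace F]

theorem sq_norm_apply_add_sq_norm_apply_le (t : F →L[ℂ] K) (b : F →L[ℂ] H) (x : F) :
    ‖t x‖ ^ 2 + ‖b x‖ ^ 2 ≤ ‖adjoint t ∘L t + adjoint b ∘L b‖ * ‖x‖ ^ 2 := by
  have h : ‖t x‖ ^ 2 + ‖b x‖ ^ 2 =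
      RCLike.re (inner ℂ ((adjoint t ∘L t + adjoint b ∘L b) x) x) := by
    rw [add_apply, inner_add_left, map_add, apply_norm_sq_eq_inner_adjoint_left,
      apply_norm_sq_eq_inner_adjoint_left]
  rw [h]
  calc _ ≤ ‖inner ℂ ((adjoint t ∘L t + adjoint b ∘L b) x) x‖ := RCLike.re_le_norm _
    _ ≤ ‖(adjoint t ∘L t + adjoint b ∘L b) x‖ * ‖x‖ := norm_inner_le_norm _ _
    _ ≤ ‖adjoint t ∘L t + adjoint b ∘L b‖ * ‖x‖ * ‖x‖ :=
      mul_le_mul_of_nonneg_right (le_opNorm _ _) (norm_nonneg x)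
    _ = _ := by ring

/-- The Cauchy–Schwarz inequality for the product of a row and a column of operators. -/
theorem sq_norm_adjoint_comp_add_le (t : H →L[ℂ] K) (b : H →L[ℂ] H)
    (p : F →L[ℂ] K) (q : F →L[ℂ] H) :
    ‖adjoint p ∘L t + adjoint q ∘L b‖ ^ 2 ≤
      ‖adjoint p ∘L p + adjoint q ∘L q‖ * ‖adjoint t ∘L t + adjoint b ∘L b‖ := by
  set σ := ‖adjoint p ∘L p + adjoint q ∘L q‖
  set τ := ‖adjoint t ∘L t + adjoint b ∘L b‖
  set R := adjoint p ∘L t + adjoint q ∘L b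
  have hσ : 0 ≤ σ := norm_nonneg _
  have hτ : 0 ≤ τ := norm_nonneg _
  have hR : ‖R‖ ≤ √σ * √τ := by
    refine opNorm_le_bound _ (by positivity) fun x => ?_
    set y := R x with hy
    have hinner : ‖y‖ ^ 2 = RCLike.re (inner ℂ (t x) (p y)) + RCLike.re (inner ℂ (b x) (q y)) := by
      rw [← inner_self_eq_norm_sq (𝕜 := ℂ) y]
      nth_rewrite 1 [hy]
      rw [add_apply, inner_add_left, map_add, comp_apply, comp_apply, adjoint_inner_left,
        adjoint_inner_left]
    have h₁ : RCLike.re (inner ℂ (t x) (p y)) ≤ ‖t x‖ * ‖p y‖ := re_inner_le_norm _ _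
    have h₂ : RCLike.re (inner ℂ (b x) (q y)) ≤ ‖b x‖ * ‖q y‖ := re_inner_le_norm _ _
    have hx := sq_norm_apply_add_sq_norm_apply_le t b x
    have hqy := sq_norm_apply_add_sq_norm_apply_le p q y
    have hfour : (‖y‖ ^ 2) ^ 2 ≤ (√σ * √τ * ‖x‖ * ‖y‖) ^ 2 := by
      calc (‖y‖ ^ 2) ^ 2 ≤ (‖t x‖ * ‖p y‖ + ‖b x‖ * ‖q y‖) ^ 2 := by
            gcongr
            linarith
        _ ≤ (‖t x‖ ^ 2 + ‖b x‖ ^ 2) * (‖p y‖ ^ 2 + ‖q y‖ ^ 2) := by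
            nlinarith [sq_nonneg (‖t x‖ * ‖q y‖ - ‖b x‖ * ‖p y‖)]
        _ ≤ (τ * ‖x‖ ^ 2) * (σ * ‖y‖ ^ 2) := by gcongr
        _ = (√σ * √τ * ‖x‖ * ‖y‖) ^ 2 := by
            rw [mul_pow, mul_pow, mul_pow, Real.sq_sqrt hσ, Real.sq_sqrt hτ]
            ring
    have hsq : ‖y‖ * ‖y‖ ≤ (√σ * √τ * ‖x‖) * ‖y‖ := by
      rw [← sq]
      exact le_of_sq_le_sq hfour (by positivity)
    rcases (norm_nonneg y).eq_or_lt with h0 | hpos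
    · rw [← h0]
      positivity
    · exact le_of_mul_le_mul_right hsq hpos
  calc ‖R‖ ^ 2 ≤ (√σ * √τ) ^ 2 := by gcongr
    _ = σ * τ := by rw [mul_pow, Real.sq_sqrt hσ, Real.sq_sqrt hτ]

end ColumnNorm

/-- The column contractivity estimate: for `t ∈ T` and `b ∈ ⟨T* T⟩`,
`‖P(t)* P(t) + Q'(b)* Q'(b)‖ ≤ ‖t* t + b* b‖`. -/
theorem column_contractivity
    (T X : Set (H →L[ℂ] K)) (P : (H →L[ℂ] K) → (H →L[ℂ] K))
    (Q' : (H →L[ℂ] H) → (H →L[ℂ] H))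
    (hT : IsTRO T) (hX : IsSubTRO T X) (hXnd : Nondegenerate T X)
    (hP : IsTROCondExp T X P) (hPc : ContractiveOn T P)
    (hQ' : IsRightCornerMap T X P Q')
    (t : H →L[ℂ] K) (ht : t ∈ T) (b : H →L[ℂ] H) (hb : b ∈ cspan (setStarMul T T)) :
    ‖ContinuousLinearMap.adjoint (P t) ∘L P t
        + ContinuousLinearMap.adjoint (Q' b) ∘L Q' b‖ ≤
      ‖ContinuousLinearMap.adjoint t ∘L t + ContinuousLinearMap.adjoint b ∘L b‖ := by
  have hspan := hXnd.cspan_eq hT hX.1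
  have hp : P t ∈ X := hP.2.2.1 t ht
  have hq := hQ'.mem_cspan hspan hP.2.2.1 hb
  set p := P t with hp_def
  set q := Q' b with hq_def
  set s := adjoint p ∘L p + adjoint q ∘L q with hs_def
  set τ := ‖adjoint t ∘L t + adjoint b ∘L b‖
  have hs : s ∈ cspan (setStarMul X X) :=
    Submodule.add_mem (Submodule.span ℂ (setStarMul X X)).topologicalClosure
      (subset_cspan _ ⟨p, hp, p, hp, rfl⟩)
      (hX.isTRO.comp_mem_cspan (adjoint_mem_cspan_setStarMul hq) hq)
  have hs_adj : adjoint s = s := by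
    simp only [hs_def, map_add, adjoint_comp, adjoint_adjoint]
  have hps : p ∘L s ∈ X := hX.isTRO.comp_mem hp hs
  have hsq : adjoint (q ∘L s) ∈ cspan (setStarMul X X) :=
    adjoint_mem_cspan_setStarMul (hX.isTRO.comp_mem_cspan hq hs)
  have hrow₁ : adjoint (p ∘L s) ∘L t ∈ cspan (setStarMul T T) :=
    subset_cspan _ ⟨_, hX.1 hps, t, ht, rfl⟩
  have hrow₂ : adjoint (q ∘L s) ∘L b ∈ cspan (setStarMul T T) :=
    hT.comp_mem_cspan (cspan_mono (setStarMul_mono hX.1 hX.1) hsq) hb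
  have hQs : Q' (adjoint (p ∘L s) ∘L t + adjoint (q ∘L s) ∘L b) = s ∘L s := by
    rw [hQ'.2.1 _ hrow₁ _ hrow₂, hQ'.2.2.2.2 t ht _ hps, hQ'.map_comp hT hX hspan hsq hb,
      ← hp_def, ← hq_def, adjoint_comp, adjoint_comp, hs_adj, comp_assoc, comp_assoc,
      ← comp_add]
  have hcontr : ‖s ∘L s‖ ≤ ‖adjoint (p ∘L s) ∘L t + adjoint (q ∘L s) ∘L b‖ := by
    rw [← hQs]
    exact hQ'.2.2.2.1 _
      (Submodule.add_mem (Submodule.span ℂ (setStarMul T T)).topologicalClosure hrow₁ hrow₂)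
  have hcube : adjoint (p ∘L s) ∘L (p ∘L s) + adjoint (q ∘L s) ∘L (q ∘L s) =
      s ∘L (s ∘L s) := by
    rw [adjoint_comp, adjoint_comp, hs_adj]
    simp only [hs_def, comp_add, add_comp, comp_assoc]
    abel
  have hnorm_sq : ‖s ∘L s‖ = ‖s‖ * ‖s‖ := by
    simpa only [hs_adj] using norm_adjoint_comp_self s
  have hCS := sq_norm_adjoint_comp_add_le t b (p ∘L s) (q ∘L s)
  rw [hcube] at hCS
  have hnorm_cube : ‖s ∘L (s ∘L s)‖ ≤ ‖s‖ ^ 3 := by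
    calc _ ≤ ‖s‖ * ‖s ∘L s‖ := opNorm_comp_le _ _
      _ = ‖s‖ ^ 3 := by rw [hnorm_sq]; ring
  have hfour : ‖s‖ ^ 3 * ‖s‖ ≤ ‖s‖ ^ 3 * τ := by
    calc ‖s‖ ^ 3 * ‖s‖ = ‖s ∘L s‖ ^ 2 := by rw [hnorm_sq]; ring
      _ ≤ ‖adjoint (p ∘L s) ∘L t + adjoint (q ∘L s) ∘L b‖ ^ 2 := by gcongr
      _ ≤ ‖s ∘L (s ∘L s)‖ * τ := hCS
      _ ≤ ‖s‖ ^ 3 * τ := mul_le_mul_of_nonneg_right hnorm_cube (norm_nonneg _)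
  rcases (norm_nonneg s).eq_or_lt with h0 | hpos
  · rw [← h0]
    exact norm_nonneg _
  · exact le_of_mul_le_mul_left hfour (by positivity)
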